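/- arXiv:2411.03230 — 2 statements merged into one kernel-verified Lean document; each statement's English description precedes it below -/
import Mathlib

section
/- For the perturbation V₁, the second-order effective interaction on the encoded qubits satisfies −E† V₁ G V₁ E = (1/27)(−20·I₄ + 4·X⊗X + 12·Z⊗Z + X⊗I₂ + I₂⊗X), for any matrix G with G = Π₊ G Π₊ and G·(Π_c H₀ Π_c)·Π₊ = Π₊. -/
open Matrix
open scoped Kronecker

noncomputable section

/-- Index type for the Fock space of 9 fermionic modes, `ℂ^512`.
Modes `i1,i2,i3,j1,j2,j3,x,y,z` are labelled `0,…,8` in this order. -/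
abbrev Idx := Fin 9 → Bool

abbrev Mat := Matrix Idx Idx ℂ

/-- Jordan–Wigner annihilation operator `a_k = Z^{⊗(k-1)} ⊗ σ⁻ ⊗ I^{⊗(9-k)}`,
written entrywise in the occupation-number basis (`false` = unoccupied `|0⟩`). -/
def a (k : Fin 9) : Mat :=
  Matrix.of fun s t =>
    if t k = true ∧ s = Function.update t k false then
      (-1 : ℂ) ^ (Finset.univ.filter fun l => l < k ∧ t l = true).card
    else 0

/-- Creation operator `a_k†`. -/
def ad (k : Fin 9) : Mat := (a k)ᴴ

/-- The vacuum state `|vac⟩ = |0⟩^{⊗9}`. -/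
def vac : Idx → ℂ := fun t => if t = (fun _ => false) then 1 else 0

/-- `√3` as a complex number. -/
def s3 : ℂ := (Real.sqrt 3 : ℝ)

/-- The edges of the constraint graph `G_c`:
`{i1,i2},{i2,i3},{i1,i3},{j1,j2},{j2,j3},{j1,j3},{i2,x},{j2,x},{i3,y},{j3,y},{i1,z},{j1,z}`. -/
def edges : Finset (Fin 9 × Fin 9) :=
  {(0,1), (1,2), (0,2), (3,4), (4,5), (3,5), (1,6), (4,6), (2,7), (5,7), (0,8), (3,8)}

/-- Adjacency in the constraint graph `G_c`. -/
def Adj (k l : Fin 9) : Prop := (k, l) ∈ edges ∨ (l, k) ∈ edges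

instance (k l : Fin 9) : Decidable (Adj k l) := by unfold Adj; infer_instance

/-- `S` is an independent set of the constraint graph `G_c`. -/
def IndepSet (S : Finset (Fin 9)) : Prop := ∀ k ∈ S, ∀ l ∈ S, ¬ Adj k l

instance (S : Finset (Fin 9)) : Decidable (IndepSet S) := by unfold IndepSet; infer_instance

/-- The Fock basis state `|S⟩` with exactly the modes in `S` occupied. -/
def fock (S : Finset (Fin 9)) : Idx → ℂ :=
  fun t => if t = (fun k => decide (k ∈ S)) then 1 else 0

/-- The set of occupied modes of an occupation vector. -/
def suppOf (t : Idx) : Finset (Fin 9) := Finset.univ.filter fun k => t k = true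

/-- The two-particle constrained subspace: the span of the Fock states `|S⟩` over
independent sets `S` of `G_c` with `|S| = 2`. -/
def C2 : Submodule ℂ (Idx → ℂ) :=
  Submodule.span ℂ {v | ∃ S : Finset (Fin 9), IndepSet S ∧ S.card = 2 ∧ v = fock S}

/-- `Π_c`, the orthogonal projector onto the two-particle constrained subspace.
Since that subspace is spanned by standard (Fock) basis vectors, the orthogonal
projector is the diagonal 0/1 matrix supported on those coordinates. -/
def Pic : Mat :=
  Matrix.diagonal fun t => if IndepSet (suppOf t) ∧ (suppOf t).card = 2 then 1 else 0

/-- `H_{0,i} = I + (a_{i1}†a_{i2}+h.c.) + (a_{i2}†a_{i3}+h.c.) + (a_{i3}†a_{i1}+h.c.)`. -/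
def H0i : Mat :=
  1 + (ad 0 * a 1 + ad 1 * a 0) + (ad 1 * a 2 + ad 2 * a 1) + (ad 2 * a 0 + ad 0 * a 2)

/-- `H_{0,j}`, defined analogously on modes `j1,j2,j3`. -/
def H0j : Mat :=
  1 + (ad 3 * a 4 + ad 4 * a 3) + (ad 4 * a 5 + ad 5 * a 4) + (ad 5 * a 3 + ad 3 * a 5)

/-- `H₀ = H_{0,i} + H_{0,j}`. -/
def H0 : Mat := H0i + H0j

/-- `S_{·,b}` on modes `k1,k2,k3`:
`S_{·,0} = (1/(2√3))((1−√3)a_{k3}† − 2a_{k1}† + (1+√3)a_{k2}†)` and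
`S_{·,1} = (1/(2√3))((1+√3)a_{k3}† − 2a_{k1}† + (1−√3)a_{k2}†)`. -/
def Senc (k1 k2 k3 : Fin 9) (b : Fin 2) : Mat :=
  if b = 0 then
    (1 / (2 * s3)) • ((1 - s3) • ad k3 - (2 : ℂ) • ad k1 + (1 + s3) • ad k2)
  else
    (1 / (2 * s3)) • ((1 + s3) • ad k3 - (2 : ℂ) • ad k1 + (1 - s3) • ad k2)

/-- The encoded two-qubit state `|bb'⟩_enc = S_{i,b} S_{j,b'} |vac⟩`. -/
def enc (b b' : Fin 2) : Idx → ℂ := (Senc 0 1 2 b * Senc 3 4 5 b').mulVec vac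

/-- The encoding isometry `E : ℂ⁴ → ℂ^512`, sending `|b⟩⊗|b'⟩` to `|bb'⟩_enc`. -/
def Eenc : Matrix Idx (Fin 2 × Fin 2) ℂ := Matrix.of fun t p => enc p.1 p.2 t

/-- `Π₋ = E E†`, the orthogonal projector onto the span of the four encoded states. -/
def Pim : Mat := Eenc * Eencᴴ

/-- `Π₊ = Π_c − Π₋`. -/
def Pip : Mat := Pic - Pim

/-- `V₁ = (a_{i2}†a_x+h.c.) + (a_{j2}†a_x+h.c.) + (a_{i3}†a_y+h.c.) + (a_{j3}†a_y+h.c.)`. -/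
def V1 : Mat :=
  (ad 1 * a 6 + ad 6 * a 1) + (ad 4 * a 6 + ad 6 * a 4)
    + (ad 2 * a 7 + ad 7 * a 2) + (ad 5 * a 7 + ad 7 * a 5)

/-- `V₂ = (a_{i1}†a_z+h.c.) + (a_{j1}†a_z+h.c.)`. -/
def V2 : Mat := (ad 0 * a 8 + ad 8 * a 0) + (ad 3 * a 8 + ad 8 * a 3)

/-- `V_main = V₁ + V₂`. -/
def Vmain : Mat := V1 + V2

/-- The Pauli matrix `X`. -/
def PX : Matrix (Fin 2) (Fin 2) ℂ := !![0, 1; 1, 0]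

/-- The Pauli matrix `Z`. -/
def PZ : Matrix (Fin 2) (Fin 2) ℂ := !![1, 0; 0, -1]

/-- The Jordan–Wigner sign picked up when acting on mode `k` of the occupation vector `t`. -/
def jwSign (k : Fin 9) (t : Idx) : ℂ :=
  (-1 : ℂ) ^ (Finset.univ.filter fun l => l < k ∧ t l = true).card

lemma jwSign_mul_self (k : Fin 9) (t : Idx) : jwSign k t * jwSign k t = 1 := by
  rw [jwSign, ← mul_pow]; simp

lemma jwSign_eq_prod (k : Fin 9) (t : Idx) :
    jwSign k t = ∏ l, if l < k ∧ t l = true then (-1 : ℂ) else 1 := by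
  rw [jwSign, Finset.prod_ite]; simp

lemma jwSign_update_true (k l : Fin 9) (t : Idx) (h : t l = false) :
    jwSign k (Function.update t l true) = (if l < k then -1 else 1) * jwSign k t := by
  rw [jwSign_eq_prod, jwSign_eq_prod, ← Finset.mul_prod_erase _ _ (Finset.mem_univ l),
    ← Finset.mul_prod_erase _ (fun m => if m < k ∧ t m = true then (-1 : ℂ) else 1)
      (Finset.mem_univ l)]
  simp only [Function.update_self, h]
  rw [Finset.prod_congr (g := fun m => if m < k ∧ t m = true then (-1 : ℂ) else 1) rfl]
  · simp
  · intro m hm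
    rw [Function.update_of_ne (Finset.ne_of_mem_erase hm)]

lemma jwSign_update_false (k l : Fin 9) (t : Idx) (h : t l = true) :
    jwSign k (Function.update t l false) = (if l < k then -1 else 1) * jwSign k t := by
  have := jwSign_update_true k l (Function.update t l false) (by simp)
  rw [Function.update_idem, Function.update_eq_self_iff.2 h.symm] at this
  rw [this]
  split_ifs <;> simp

lemma a_mulVec_single (k : Fin 9) (t : Idx) :
    a k *ᵥ Pi.single t 1 =
      if t k = true then jwSign k t • Pi.single (Function.update t k false) 1 else 0 := by
  ext s
  rw [Matrix.mulVec_single_one]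
  by_cases h : t k = true <;> by_cases hs : s = Function.update t k false <;>
    simp [a, jwSign, h, hs]

lemma ad_mulVec_single (k : Fin 9) (t : Idx) :
    ad k *ᵥ Pi.single t 1 =
      if t k = true then 0 else jwSign k t • Pi.single (Function.update t k true) 1 := by
  ext s
  rw [Matrix.mulVec_single_one]
  by_cases h : s k = true ∧ t = Function.update s k false
  · obtain ⟨h1, rfl⟩ := h
    have := jwSign_update_false k k s h1
    simp only [lt_irrefl, if_false, one_mul] at this
    have hs : Function.update s k true = s := by rw [← h1, Function.update_eq_self]
    simp only [Function.update_self, this, Function.update_idem, hs]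
    simp [ad, a, jwSign, h1]
  · have h0 : (ad k) s t = 0 := by simp [ad, a, h]
    rw [Matrix.col_apply, h0]
    split_ifs with ht
    · rfl
    · have hne : s ≠ Function.update t k true := by
        rintro rfl
        apply h
        simp only [Function.update_self, Function.update_idem, true_and]
        rw [Bool.not_eq_true] at ht
        rw [← ht, Function.update_eq_self]
      simp [hne]

/-- The canonical anticommutation relation between annihilation and creation operators. -/
lemma a_mul_ad (k l : Fin 9) :
    a k * ad l = (if k = l then 1 else 0) - ad l * a k := by
  apply Matrix.ext_of_mulVec_single
  intro t
  rw [Matrix.sub_mulVec, ← Matrix.mulVec_mulVec, ← Matrix.mulVec_mulVec, a_mulVec_single,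
    ad_mulVec_single]
  rcases eq_or_ne k l with rfl | hkl
  · have hu (b : Bool) (h : t k = b) : Function.update t k b = t := by
      rw [← h, Function.update_eq_self]
    cases h : t k
    · have := jwSign_update_true k k t h
      simp [-Matrix.mulVec_single, Matrix.mulVec_smul, a_mulVec_single, this, smul_smul, jwSign_mul_self, hu _ h]
    · have := jwSign_update_false k k t h
      simp [-Matrix.mulVec_single, Matrix.mulVec_smul, ad_mulVec_single, this, smul_smul, jwSign_mul_self, hu _ h]
  · cases hl : t l <;> cases hk : t k <;>
      simp [-Matrix.mulVec_single, Matrix.mulVec_smul, a_mulVec_single, ad_mulVec_single, hkl, hkl.symm, hl, hk, smul_smul]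
    rw [jwSign_update_true _ _ _ hl, jwSign_update_false _ _ _ hk,
      Function.update_comm hkl, ← neg_smul]
    congr 1
    rcases lt_or_gt_of_ne hkl with h | h <;> simp [h, not_lt.2 h.le, mul_comm]

lemma vac_eq_single : vac = Pi.single (fun _ => false) 1 := by
  ext t; simp [vac, Pi.single_apply]

lemma a_mulVec_vac (k : Fin 9) : a k *ᵥ vac = 0 := by
  rw [vac_eq_single, a_mulVec_single]; simp

/-- The two-particle state `a_k† a_l† |vac⟩`. -/
def pairState (k l : Fin 9) : Idx → ℂ := ad k *ᵥ (ad l *ᵥ vac)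

lemma a_mulVec_ad_mulVec (k l : Fin 9) (v : Idx → ℂ) :
    a k *ᵥ (ad l *ᵥ v) = (if k = l then (1 : ℂ) else 0) • v - ad l *ᵥ (a k *ᵥ v) := by
  rw [Matrix.mulVec_mulVec, a_mul_ad, Matrix.sub_mulVec, Matrix.mulVec_mulVec]
  split_ifs <;> simp

lemma a_mulVec_pairState (q k l : Fin 9) :
    a q *ᵥ pairState k l = (if q = k then (1 : ℂ) else 0) • (ad l *ᵥ vac)
      - (if q = l then (1 : ℂ) else 0) • (ad k *ᵥ vac) := by
  rw [pairState, a_mulVec_ad_mulVec, a_mulVec_ad_mulVec, a_mulVec_vac, Matrix.mulVec_zero, sub_zero,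
    Matrix.mulVec_smul]

lemma pairState_swap (k l : Fin 9) : pairState k l = -pairState l k := by
  rw [pairState, pairState, vac_eq_single, ad_mulVec_single, ad_mulVec_single]
  rcases eq_or_ne k l with rfl | hkl
  · simp [-Matrix.mulVec_single, Matrix.mulVec_smul, ad_mulVec_single]
  · simp [-Matrix.mulVec_single, Matrix.mulVec_smul, ad_mulVec_single, hkl, hkl.symm, smul_smul]
    rw [jwSign_update_true _ _ _ rfl, jwSign_update_true _ _ _ rfl,
      Function.update_comm hkl, ← neg_smul]
    congr 1
    rcases lt_or_gt_of_ne hkl with h | h <;> simp [h, not_lt.2 h.le, mul_comm]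

lemma hop_mulVec_pairState (p q k l : Fin 9) :
    (ad p * a q) *ᵥ pairState k l = (if q = k then (1 : ℂ) else 0) • pairState p l
      + (if q = l then (1 : ℂ) else 0) • pairState k p := by
  rw [← Matrix.mulVec_mulVec, a_mulVec_pairState, Matrix.mulVec_sub, Matrix.mulVec_smul,
    Matrix.mulVec_smul, pairState_swap k p]
  simp only [pairState]
  module

lemma star_ad_mulVec_dotProduct (k : Fin 9) (v w : Idx → ℂ) :
    star (ad k *ᵥ v) ⬝ᵥ w = star v ⬝ᵥ (a k *ᵥ w) := by
  rw [Matrix.star_mulVec, ad, Matrix.conjTranspose_conjTranspose, Matrix.dotProduct_mulVec]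

lemma star_pairState_dotProduct (k l m n : Fin 9) :
    star (pairState k l) ⬝ᵥ pairState m n =
      (if k = m ∧ l = n then (1 : ℂ) else 0) - (if k = n ∧ l = m then (1 : ℂ) else 0) := by
  have hv : star vac ⬝ᵥ vac = 1 := by simp [vac_eq_single]
  have h1 (i j : Fin 9) : star (ad i *ᵥ vac) ⬝ᵥ (ad j *ᵥ vac) = if i = j then 1 else 0 := by
    rw [star_ad_mulVec_dotProduct, a_mulVec_ad_mulVec, a_mulVec_vac]
    rw [Matrix.mulVec_zero, sub_zero, dotProduct_smul, hv, smul_eq_mul, mul_one]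
  rw [pairState, star_ad_mulVec_dotProduct, a_mulVec_pairState, dotProduct_sub,
    dotProduct_smul, dotProduct_smul, h1, h1]
  split_ifs <;> simp_all

lemma Pic_mulVec_pairState (k l : Fin 9) :
    Pic *ᵥ pairState k l = (if Adj k l then (0 : ℂ) else 1) • pairState k l := by
  rw [pairState, vac_eq_single, ad_mulVec_single]
  simp only [Bool.false_eq_true, if_false, Matrix.mulVec_smul, ad_mulVec_single]
  rcases eq_or_ne k l with rfl | hkl
  · simp
  · have key : ∀ k l : Fin 9, k ≠ l →
        ((IndepSet (suppOf (Function.update (Function.update (fun _ => false) l true) k true)) ∧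
        (suppOf (Function.update (Function.update (fun _ => false) l true) k true)).card = 2) ↔
          ¬ Adj k l) := by decide +kernel
    simp only [Function.update_of_ne hkl, Bool.false_eq_true, if_false, Matrix.mulVec_smul,
      Pic, Matrix.diagonal_mulVec_single, mul_one, key k l hkl]
    split_ifs <;> simp_all

/-- The two-particle product state with amplitudes `α` on `i1,i2,i3` and `β` on `j1,j2,j3`. -/
def prodState (α β : Fin 3 → ℂ) : Idx → ℂ :=
  (α 0 * β 0) • pairState 0 3 + (α 0 * β 1) • pairState 0 4 + (α 0 * β 2) • pairState 0 5
    + (α 1 * β 0) • pairState 1 3 + (α 1 * β 1) • pairState 1 4 + (α 1 * β 2) • pairState 1 5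
    + (α 2 * β 0) • pairState 2 3 + (α 2 * β 1) • pairState 2 4 + (α 2 * β 2) • pairState 2 5

/-- The preimage under `Π_c H₀ Π_c` of the constrained part of `V₁` applied to a product state. -/
def resolventState (α β : Fin 3 → ℂ) : Idx → ℂ :=
  (1 / 3 : ℂ) •
    ((α 1 * (2 * β 0 - β 2)) • pairState 6 3 + (α 1 * (2 * β 2 - β 0)) • pairState 6 5
      + (β 1 * (2 * α 0 - α 2)) • pairState 0 6 + (β 1 * (2 * α 2 - α 0)) • pairState 2 6
      + (α 2 * (2 * β 0 - β 1)) • pairState 7 3 + (α 2 * (2 * β 1 - β 0)) • pairState 7 4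
      + (β 2 * (2 * α 0 - α 1)) • pairState 0 7 + (β 2 * (2 * α 1 - α 0)) • pairState 1 7)

lemma V1_mulVec_prodState (α β : Fin 3 → ℂ) :
    V1 *ᵥ prodState α β =
      α 1 • (β 0 • pairState 6 3 + β 1 • pairState 6 4 + β 2 • pairState 6 5)
        + β 1 • (α 0 • pairState 0 6 + α 1 • pairState 1 6 + α 2 • pairState 2 6)
        + α 2 • (β 0 • pairState 7 3 + β 1 • pairState 7 4 + β 2 • pairState 7 5)
        + β 2 • (α 0 • pairState 0 7 + α 1 • pairState 1 7 + α 2 • pairState 2 7) := by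
  simp only [V1, prodState, Matrix.add_mulVec, Matrix.mulVec_add, Matrix.mulVec_smul,
    hop_mulVec_pairState]
  simp only [Fin.reduceEq, if_true, if_false, zero_smul, one_smul, add_zero, zero_add, smul_zero]
  module

lemma Pic_mulVec_V1_mulVec_prodState (α β : Fin 3 → ℂ) :
    Pic *ᵥ (V1 *ᵥ prodState α β) =
      α 1 • (β 0 • pairState 6 3 + β 2 • pairState 6 5)
        + β 1 • (α 0 • pairState 0 6 + α 2 • pairState 2 6)
        + α 2 • (β 0 • pairState 7 3 + β 1 • pairState 7 4)
        + β 2 • (α 0 • pairState 0 7 + α 1 • pairState 1 7) := by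
  rw [V1_mulVec_prodState]
  simp only [Matrix.mulVec_add, Matrix.mulVec_smul, Pic_mulVec_pairState]
  simp [Adj, edges]

lemma Pic_mulVec_resolventState (α β : Fin 3 → ℂ) :
    Pic *ᵥ resolventState α β = resolventState α β := by
  simp only [resolventState, Matrix.mulVec_add, Matrix.mulVec_smul, Pic_mulVec_pairState]
  simp [Adj, edges]

lemma Pic_mulVec_H0_mulVec_resolventState (α β : Fin 3 → ℂ) :
    Pic *ᵥ (H0 *ᵥ resolventState α β) = Pic *ᵥ (V1 *ᵥ prodState α β) := by
  rw [Pic_mulVec_V1_mulVec_prodState]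
  simp only [resolventState, H0, H0i, H0j, Matrix.add_mulVec, Matrix.mulVec_add, Matrix.mulVec_smul,
    Matrix.one_mulVec, hop_mulVec_pairState]
  simp only [Fin.reduceEq, if_true, if_false, zero_smul, one_smul, add_zero, zero_add]
  simp only [Pic_mulVec_pairState]
  simp [Adj, edges]
  module

lemma star_prodState_dotProduct_V1_mulVec (α β α' β' : Fin 3 → ℂ) :
    star (prodState α β) ⬝ᵥ (V1 *ᵥ prodState α' β') = 0 := by
  rw [V1_mulVec_prodState]
  simp only [prodState, star_add, star_smul, add_dotProduct, dotProduct_add, smul_dotProduct,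
    dotProduct_smul, star_pairState_dotProduct]
  simp

lemma star_prodState_dotProduct_resolventState (α β α' β' : Fin 3 → ℂ) :
    star (prodState α β) ⬝ᵥ resolventState α' β' = 0 := by
  simp only [resolventState, prodState, star_add, star_smul, add_dotProduct, dotProduct_add,
    smul_dotProduct, dotProduct_smul, star_pairState_dotProduct]
  simp

lemma star_V1_mulVec_prodState_dotProduct_resolventState (α β α' β' : Fin 3 → ℂ) :
    star (V1 *ᵥ prodState α β) ⬝ᵥ resolventState α' β' =
      (1 / 3) *
        (star (α 1) * α' 1 * (star (β 0) * (2 * β' 0 - β' 2) + star (β 2) * (2 * β' 2 - β' 0))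
        + star (β 1) * β' 1 * (star (α 0) * (2 * α' 0 - α' 2) + star (α 2) * (2 * α' 2 - α' 0))
        + star (α 2) * α' 2 * (star (β 0) * (2 * β' 0 - β' 1) + star (β 1) * (2 * β' 1 - β' 0))
        + star (β 2) * β' 2 * (star (α 0) * (2 * α' 0 - α' 1) + star (α 1) * (2 * α' 1 - α' 0))) := by
  rw [V1_mulVec_prodState]
  simp only [resolventState, star_add, star_smul, add_dotProduct, dotProduct_add,
    smul_dotProduct, dotProduct_smul, star_pairState_dotProduct]
  simp
  ring

/-- The amplitudes of the encoded state `b` on the three modes of a triangle. -/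
def encAmp (b : Fin 2) : Fin 3 → ℂ :=
  if b = 0 then (1 / (2 * s3)) • ![-2, 1 + s3, 1 - s3] else (1 / (2 * s3)) • ![-2, 1 - s3, 1 + s3]

lemma Senc_eq_encAmp (k₁ k₂ k₃ : Fin 9) (b : Fin 2) :
    Senc k₁ k₂ k₃ b = encAmp b 0 • ad k₁ + encAmp b 1 • ad k₂ + encAmp b 2 • ad k₃ := by
  rw [Senc, encAmp]
  split_ifs <;> simp <;> module

lemma enc_eq_prodState (b b' : Fin 2) : enc b b' = prodState (encAmp b) (encAmp b') := by
  rw [enc, Senc_eq_encAmp, Senc_eq_encAmp, ← Matrix.mulVec_mulVec]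
  simp only [prodState, pairState, Matrix.add_mulVec, Matrix.mulVec_add, Matrix.smul_mulVec,
    Matrix.mulVec_smul]
  module

lemma s3_mul_self : s3 * s3 = 3 := by
  rw [s3, ← Complex.ofReal_mul, Real.mul_self_sqrt (by norm_num)]; norm_num

lemma star_s3 : star s3 = s3 := Complex.conj_ofReal _

lemma star_encAmp (b : Fin 2) (k : Fin 3) : star (encAmp b k) = encAmp b k := by
  fin_cases b <;> fin_cases k <;> simp [encAmp, ← starRingEnd_apply] <;>
    simp [starRingEnd_apply, star_s3]

lemma conjTranspose_V1 : V1ᴴ = V1 := by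
  simp only [V1, ad, Matrix.conjTranspose_add, Matrix.conjTranspose_mul,
    Matrix.conjTranspose_conjTranspose]
  abel

lemma Pip_mulVec_of_orthogonal (v : Idx → ℂ) (h : ∀ b b', star (enc b b') ⬝ᵥ v = 0) :
    Pip *ᵥ v = Pic *ᵥ v := by
  have h0 : Eencᴴ *ᵥ v = 0 := by
    ext p
    exact h p.1 p.2
  rw [Pip, Matrix.sub_mulVec, Pim, ← Matrix.mulVec_mulVec, h0, Matrix.mulVec_zero, sub_zero]

/-- Any reduced resolvent of `Π_c H₀ Π_c` sends `V₁|bb'⟩_enc` to the explicit resolvent state. -/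
lemma mulVec_V1_mulVec_enc (G : Mat) (hG : G = Pip * G * Pip)
    (hGinv : G * (Pic * H0 * Pic) * Pip = Pip) (b b' : Fin 2) :
    G *ᵥ (V1 *ᵥ enc b b') = resolventState (encAmp b) (encAmp b') := by
  set u := resolventState (encAmp b) (encAmp b') with hu
  have hPu : Pip *ᵥ u = u := by
    rw [Pip_mulVec_of_orthogonal, hu, Pic_mulVec_resolventState]
    intro c c'
    rw [enc_eq_prodState, star_prodState_dotProduct_resolventState]
  have hPV : Pip *ᵥ (V1 *ᵥ enc b b') = Pic *ᵥ (V1 *ᵥ enc b b') := by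
    apply Pip_mulVec_of_orthogonal
    intro c c'
    rw [enc_eq_prodState, enc_eq_prodState, star_prodState_dotProduct_V1_mulVec]
  have hK : G *ᵥ (Pic *ᵥ (V1 *ᵥ enc b b')) = u := by
    have := congrArg (· *ᵥ u) hGinv
    simp only [← Matrix.mulVec_mulVec, hPu] at this
    rwa [hu, Pic_mulVec_resolventState, Pic_mulVec_H0_mulVec_resolventState, ← hu,
      ← enc_eq_prodState] at this
  rw [hG, ← Matrix.mulVec_mulVec, ← Matrix.mulVec_mulVec, hPV, hK, hPu]

/-!
STATEMENT 4: The second-order effective interaction of `V₁` on the encoded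
qubits: `−E† V₁ G V₁ E = (1/27)(−20·I₄ + 4·X⊗X + 12·Z⊗Z + X⊗I₂ + I₂⊗X)` for
any `G` with `G = Π₊ G Π₊` and `G (Π_c H₀ Π_c) Π₊ = Π₊`.
-/

theorem statement4 (G : Mat) (hG : G = Pip * G * Pip)
    (hGinv : G * (Pic * H0 * Pic) * Pip = Pip) :
    -(Eencᴴ * V1 * G * V1 * Eenc) =
      (1 / 27 : ℂ) •
        ((-20 : ℂ) • (1 : Matrix (Fin 2 × Fin 2) (Fin 2 × Fin 2) ℂ)
          + (4 : ℂ) • (PX ⊗ₖ PX) + (12 : ℂ) • (PZ ⊗ₖ PZ)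
          + PX ⊗ₖ (1 : Matrix (Fin 2) (Fin 2) ℂ)
          + (1 : Matrix (Fin 2) (Fin 2) ℂ) ⊗ₖ PX) := by
  have key (p q : Fin 2 × Fin 2) : (Eencᴴ * V1 * G * V1 * Eenc) p q =
      star (V1 *ᵥ enc p.1 p.2) ⬝ᵥ (G *ᵥ (V1 *ᵥ enc q.1 q.2)) := by
    rw [Matrix.star_mulVec, conjTranspose_V1, Matrix.mulVec_mulVec, ← Matrix.dotProduct_mulVec,
      Matrix.mulVec_mulVec]
    rw [show Eencᴴ * V1 * G * V1 * Eenc = Eencᴴ * ((V1 * (G * V1)) * Eenc) by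
      simp only [Matrix.mul_assoc]]
    rfl
  have hs : s3 ≠ 0 := by
    intro h
    simpa [h] using s3_mul_self
  have hs2 : s3 ^ 2 = 3 := by rw [sq, s3_mul_self]
  have hs4 : s3 ^ 4 = 9 := by linear_combination (s3 ^ 2 + 3) * hs2
  ext ⟨p, p'⟩ ⟨q, q'⟩
  rw [Matrix.neg_apply, key, mulVec_V1_mulVec_enc G hG hGinv, enc_eq_prodState,
    star_V1_mulVec_prodState_dotProduct_resolventState]
  simp only [star_encAmp]
  fin_cases p <;> fin_cases p' <;> fin_cases q <;> fin_cases q' <;>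
    simp [encAmp, PX, PZ] <;> field_simp <;> ring_nf <;> simp only [hs2, hs4] <;> norm_num

end
end

section
/- In the Laplacian gadget, the four encoded two-qubit states |bb'⟩_enc (b,b' ∈ {0,1}) lie in the two-particle constrained subspace and satisfy (Π_c H₀' Π_c)|bb'⟩_enc = 0. -/
open Matrix
open scoped Kronecker

noncomputable section

/-- `P_k = ∏_{l : {k,l} ∈ E(G_c)} (I − n_l)`, the product over the neighbours of
`k` in the constraint graph (the factors pairwise commute, so the product is
taken over the neighbours listed in increasing order). -/
def Pk (k : Fin 9) : Mat :=
  ((((Finset.univ.filter fun l => Adj k l)).sort (· ≤ ·)).map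
    fun l => (1 : Mat) - ad l * a l).prod

/-- The Laplacian-gadget unperturbed Hamiltonian
`H₀' = (a_{i1}†a_{i2}+h.c.) + (a_{i2}†a_{i3}+h.c.) + (a_{i3}†a_{i1}+h.c.)
     + (a_{j1}†a_{j2}+h.c.) + (a_{j2}†a_{j3}+h.c.) + (a_{j3}†a_{j1}+h.c.)
     + P_{i1} + P_{i2} + P_{i3} + P_{j1} + P_{j2} + P_{j3}`. -/
def H0' : Mat :=
  (ad 0 * a 1 + ad 1 * a 0) + (ad 1 * a 2 + ad 2 * a 1) + (ad 2 * a 0 + ad 0 * a 2)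
    + (ad 3 * a 4 + ad 4 * a 3) + (ad 4 * a 5 + ad 5 * a 4) + (ad 5 * a 3 + ad 3 * a 5)
    + Pk 0 + Pk 1 + Pk 2 + Pk 3 + Pk 4 + Pk 5

/-- The number of modes of `S` preceding `k`, the exponent of the Jordan–Wigner sign. -/
def jwCount (k : Fin 9) (S : Finset (Fin 9)) : ℕ := (S.filter (· < k)).card

theorem fock_eq_single (S : Finset (Fin 9)) :
    fock S = Pi.single (fun k => decide (k ∈ S)) 1 := by
  ext t
  simp [fock, Pi.single_apply]

theorem card_filter_lt_occupied (k : Fin 9) (S : Finset (Fin 9)) :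
    (Finset.univ.filter fun l => l < k ∧ l ∈ S).card = jwCount k S := by
  unfold jwCount
  congr 1
  ext l
  simp [and_comm]

theorem a_mulVec_fock (k : Fin 9) (S : Finset (Fin 9)) :
    a k *ᵥ fock S = if k ∈ S then (-1 : ℂ) ^ jwCount k S • fock (S.erase k) else 0 := by
  ext s
  rw [fock_eq_single, mulVec_single_one]
  simp only [a, col_apply, of_apply, decide_eq_true_eq, card_filter_lt_occupied]
  have hup : Function.update (fun l => decide (l ∈ S)) k false
      = fun l => decide (l ∈ S.erase k) := by
    ext l
    by_cases h : l = k
    · subst h; simp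
    · simp [h]
  rw [hup]
  by_cases hk : k ∈ S <;> simp [hk, fock]

theorem ad_mulVec_fock (k : Fin 9) (S : Finset (Fin 9)) :
    ad k *ᵥ fock S = if k ∈ S then 0 else (-1 : ℂ) ^ jwCount k S • fock (insert k S) := by
  ext s
  rw [fock_eq_single, mulVec_single_one]
  simp only [ad, a, col_apply, conjTranspose_apply, of_apply]
  have hup : (s k = true ∧ (fun l => decide (l ∈ S)) = Function.update s k false) ↔
      (k ∉ S ∧ s = fun l => decide (l ∈ insert k S)) := by
    constructor
    · rintro ⟨h, e⟩
      have e' := fun l => congrFun e l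
      refine ⟨by simpa using e' k, ?_⟩
      ext l
      by_cases hl : l = k
      · subst hl; simp [h]
      · simpa [hl] using (e' l).symm
    · rintro ⟨h, rfl⟩
      refine ⟨by simp, ?_⟩
      ext l
      by_cases hl : l = k
      · subst hl; simp [h]
      · simp [hl]
  by_cases hs : k ∉ S ∧ s = fun l => decide (l ∈ insert k S)
  · rw [if_pos (hup.2 hs)]
    obtain ⟨hk, rfl⟩ := hs
    have hc : jwCount k (insert k S) = jwCount k S := by
      simp [jwCount, Finset.filter_insert]
    simp only [decide_eq_true_eq, card_filter_lt_occupied, hc]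
    simp [hk, fock]
  · rw [if_neg (fun h => hs (hup.1 h))]
    by_cases hk : k ∈ S
    · simp [hk]
    · have : ¬ s = fun l => decide (l ∈ insert k S) := fun h => hs ⟨hk, h⟩
      simp only [hk, if_false, Pi.smul_apply, fock, this, star_zero, smul_zero]

theorem ad_mul_a_mulVec_fock (k l : Fin 9) (S : Finset (Fin 9)) :
    (ad k * a l) *ᵥ fock S = if l ∈ S ∧ k ∉ S.erase l then
      (-1 : ℂ) ^ (jwCount l S + jwCount k (S.erase l)) • fock (insert k (S.erase l)) else 0 := by
  rw [← mulVec_mulVec, a_mulVec_fock]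
  by_cases hl : l ∈ S
  · rw [if_pos hl, mulVec_smul, ad_mulVec_fock]
    by_cases hk : k ∈ S.erase l
    · simp [hk]
    · rw [if_neg hk, if_pos ⟨hl, hk⟩, smul_smul, pow_add]
  · simp [hl]

theorem number_mulVec_fock (l : Fin 9) (S : Finset (Fin 9)) :
    (ad l * a l) *ᵥ fock S = if l ∈ S then fock S else 0 := by
  rw [ad_mul_a_mulVec_fock]
  by_cases hl : l ∈ S
  · have hc : jwCount l (S.erase l) = jwCount l S := by
      unfold jwCount
      congr 1
      ext m
      simp only [Finset.mem_filter, Finset.mem_erase]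
      exact ⟨fun h => ⟨h.1.2, h.2⟩, fun h => ⟨⟨h.2.ne, h.1⟩, h.2⟩⟩
    simp [hl, hc, Finset.insert_erase hl, ← two_mul]
  · simp [hl]

theorem prod_one_sub_number_mulVec_fock (L : List (Fin 9)) (S : Finset (Fin 9)) :
    (L.map fun l => (1 : Mat) - ad l * a l).prod *ᵥ fock S
      = if ∀ l ∈ L, l ∉ S then fock S else 0 := by
  induction L with
  | nil => simp
  | cons l L ih =>
    rw [List.map_cons, List.prod_cons, ← mulVec_mulVec, ih]
    by_cases hL : ∀ m ∈ L, m ∉ S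
    · rw [if_pos hL, sub_mulVec, one_mulVec, number_mulVec_fock]
      by_cases hl : l ∈ S
      · simp [hl]
      · rw [if_neg hl, if_pos, sub_zero]
        simpa [hl] using hL
    · rw [if_neg hL, mulVec_zero, if_neg]
      exact fun h => hL fun m hm => h m (List.mem_cons_of_mem l hm)

theorem Pk_mulVec_fock (k : Fin 9) (S : Finset (Fin 9)) :
    Pk k *ᵥ fock S = if ∀ l, Adj k l → l ∉ S then fock S else 0 := by
  simp [Pk, prod_one_sub_number_mulVec_fock]

/-- The mode `i_{p+1}`. -/
def iMode (p : Fin 3) : Fin 9 := ⟨p, by omega⟩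

/-- The mode `j_{q+1}`. -/
def jMode (q : Fin 3) : Fin 9 := ⟨q + 3, by omega⟩

/-- The Fock state with one particle in each triangle. -/
def ket (p q : Fin 3) : Idx → ℂ := fock {iMode p, jMode q}

theorem indepSet_pair (p q : Fin 3) : IndepSet {iMode p, jMode q} := by
  decide +revert

theorem card_pair (p q : Fin 3) : ({iMode p, jMode q} : Finset (Fin 9)).card = 2 := by
  decide +revert

theorem hop_i_mulVec_ket (k l p q : Fin 3) :
    (ad (iMode k) * a (iMode l)) *ᵥ ket p q = if p = l then ket k q else 0 := by
  have h : iMode l ∈ ({iMode p, jMode q} : Finset (Fin 9)) ∧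
      iMode k ∉ ({iMode p, jMode q} : Finset (Fin 9)).erase (iMode l) ↔ p = l := by
    decide +revert
  rw [ket, ad_mul_a_mulVec_fock, if_congr h rfl rfl]
  split_ifs with hp
  · subst hp
    have he : Even (jwCount (iMode p) {iMode p, jMode q} +
        jwCount (iMode k) (({iMode p, jMode q} : Finset (Fin 9)).erase (iMode p))) := by
      clear h
      decide +revert
    have hs : insert (iMode k) (({iMode p, jMode q} : Finset (Fin 9)).erase (iMode p))
        = {iMode k, jMode q} := by
      clear h he
      decide +revert
    rw [he.neg_one_pow, one_smul, hs, ket]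
  · rfl

theorem hop_j_mulVec_ket (k l p q : Fin 3) :
    (ad (jMode k) * a (jMode l)) *ᵥ ket p q = if q = l then ket p k else 0 := by
  have h : jMode l ∈ ({iMode p, jMode q} : Finset (Fin 9)) ∧
      jMode k ∉ ({iMode p, jMode q} : Finset (Fin 9)).erase (jMode l) ↔ q = l := by
    decide +revert
  rw [ket, ad_mul_a_mulVec_fock, if_congr h rfl rfl]
  split_ifs with hp
  · subst hp
    have he : Even (jwCount (jMode q) {iMode p, jMode q} +
        jwCount (jMode k) (({iMode p, jMode q} : Finset (Fin 9)).erase (jMode q))) := by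
      clear h
      decide +revert
    have hs : insert (jMode k) (({iMode p, jMode q} : Finset (Fin 9)).erase (jMode q))
        = {iMode p, jMode k} := by
      clear h he
      decide +revert
    rw [he.neg_one_pow, one_smul, hs, ket]
  · rfl

theorem Pk_iMode_mulVec_ket (k p q : Fin 3) :
    Pk (iMode k) *ᵥ ket p q = if p = k then ket p q else 0 := by
  have h : (∀ l, Adj (iMode k) l → l ∉ ({iMode p, jMode q} : Finset (Fin 9))) ↔ p = k := by
    decide +revert
  rw [ket, Pk_mulVec_fock, if_congr h rfl rfl]

theorem Pk_jMode_mulVec_ket (k p q : Fin 3) :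
    Pk (jMode k) *ᵥ ket p q = if q = k then ket p q else 0 := by
  have h : (∀ l, Adj (jMode k) l → l ∉ ({iMode p, jMode q} : Finset (Fin 9))) ↔ q = k := by
    decide +revert
  rw [ket, Pk_mulVec_fock, if_congr h rfl rfl]

theorem H0'_eq : H0' =
    (ad (iMode 0) * a (iMode 1) + ad (iMode 1) * a (iMode 0))
    + (ad (iMode 1) * a (iMode 2) + ad (iMode 2) * a (iMode 1))
    + (ad (iMode 2) * a (iMode 0) + ad (iMode 0) * a (iMode 2))
    + (ad (jMode 0) * a (jMode 1) + ad (jMode 1) * a (jMode 0))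
    + (ad (jMode 1) * a (jMode 2) + ad (jMode 2) * a (jMode 1))
    + (ad (jMode 2) * a (jMode 0) + ad (jMode 0) * a (jMode 2))
    + Pk (iMode 0) + Pk (iMode 1) + Pk (iMode 2)
    + Pk (jMode 0) + Pk (jMode 1) + Pk (jMode 2) := rfl

/-- On states with one particle in each triangle, `H₀'` acts on each triangle as the
all-ones matrix. -/
theorem H0'_mulVec_ket (p q : Fin 3) :
    H0' *ᵥ ket p q = ∑ p', ket p' q + ∑ q', ket p q' := by
  simp only [H0'_eq, add_mulVec, hop_i_mulVec_ket, hop_j_mulVec_ket, Pk_iMode_mulVec_ket,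
    Pk_jMode_mulVec_ket, Fin.sum_univ_three]
  fin_cases p <;> fin_cases q <;> simp <;> abel

theorem H0'_mulVec_sum_ket {c d : Fin 3 → ℂ} (hc : ∑ p, c p = 0) (hd : ∑ q, d q = 0) :
    H0' *ᵥ (∑ p, ∑ q, (c p * d q) • ket p q) = 0 := by
  simp only [mulVec_sum, mulVec_smul, H0'_mulVec_ket, smul_add, Finset.sum_add_distrib]
  have h1 : ∑ p, ∑ q, (c p * d q) • ∑ p', ket p' q = 0 := by
    rw [Finset.sum_comm]
    simp only [← Finset.sum_smul, ← Finset.sum_mul, hc, zero_mul, zero_smul,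
      Finset.sum_const_zero]
  have h2 : ∑ p, ∑ q, (c p * d q) • ∑ q', ket p q' = 0 := by
    simp only [← Finset.sum_smul, ← Finset.mul_sum, hd, mul_zero, zero_smul,
      Finset.sum_const_zero]
  rw [h1, h2, add_zero]

theorem ad_mul_ad_mulVec_vac (p q : Fin 3) :
    ad (iMode p) *ᵥ (ad (jMode q) *ᵥ vac) = ket p q := by
  have hv : vac = fock ∅ := by
    ext t
    simp [vac, fock]
  have hp : iMode p ∉ (insert (jMode q) ∅ : Finset (Fin 9)) := by decide +revert
  have hc : jwCount (iMode p) (insert (jMode q) ∅) = 0 := by decide +revert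
  have hc' : jwCount (jMode q) ∅ = 0 := by decide +revert
  rw [hv, ad_mulVec_fock, if_neg (Finset.notMem_empty _), hc', pow_zero, one_smul,
    ad_mulVec_fock, if_neg hp, hc, pow_zero, one_smul, insert_empty_eq, ket]

/-- The amplitudes of the single-triangle encoded states. -/
def encCoeff (b : Fin 2) : Fin 3 → ℂ :=
  if b = 0 then (1 / (2 * s3)) • ![-2, 1 + s3, 1 - s3]
  else (1 / (2 * s3)) • ![-2, 1 - s3, 1 + s3]

theorem sum_encCoeff (b : Fin 2) : ∑ p, encCoeff b p = 0 := by
  unfold encCoeff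
  split_ifs <;> simp [Fin.sum_univ_three] <;> ring

theorem Senc_eq_sum (m : Fin 3 → Fin 9) (b : Fin 2) :
    Senc (m 0) (m 1) (m 2) b = ∑ p, encCoeff b p • ad (m p) := by
  unfold Senc encCoeff
  split_ifs <;> simp [Fin.sum_univ_three] <;> module

theorem enc_eq_sum_ket (b b' : Fin 2) :
    enc b b' = ∑ p, ∑ q, (encCoeff b p * encCoeff b' q) • ket p q := by
  change (Senc (iMode 0) (iMode 1) (iMode 2) b * Senc (jMode 0) (jMode 1) (jMode 2) b') *ᵥ vac = _
  rw [Senc_eq_sum, Senc_eq_sum, ← mulVec_mulVec]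
  simp only [sum_mulVec, smul_mulVec, mulVec_sum, mulVec_smul, ad_mul_ad_mulVec_vac,
    Finset.smul_sum, smul_smul]
  rw [Finset.sum_comm]
  simp only [mul_comm]

theorem enc_mem_C2 (b b' : Fin 2) : enc b b' ∈ C2 := by
  rw [enc_eq_sum_ket]
  exact Submodule.sum_mem _ fun p _ => Submodule.sum_mem _ fun q _ =>
    Submodule.smul_mem _ _ (Submodule.subset_span ⟨_, indepSet_pair p q, card_pair p q, rfl⟩)

theorem Pic_mulVec_of_mem {v : Idx → ℂ} (hv : v ∈ C2) : Pic *ᵥ v = v := by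
  induction hv using Submodule.span_induction with
  | mem x hx =>
    obtain ⟨S, hS, hcard, rfl⟩ := hx
    have hsupp : suppOf (fun k => decide (k ∈ S)) = S := by
      ext k
      simp [suppOf]
    ext t
    rw [Pic, mulVec_diagonal]
    by_cases ht : t = fun k => decide (k ∈ S)
    · rw [ht, hsupp, if_pos ⟨hS, hcard⟩, one_mul]
    · simp [fock, ht]
  | zero => exact mulVec_zero _
  | add x y _ _ hx hy => rw [mulVec_add, hx, hy]
  | smul c x _ hx => rw [mulVec_smul, hx]

/-!
STATEMENT 13: In the Laplacian gadget, the four encoded two-qubit states lie in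
the two-particle constrained subspace and satisfy `(Π_c H₀' Π_c)|bb'⟩_enc = 0`.
-/

theorem statement13 :
    (∀ b b' : Fin 2, enc b b' ∈ C2) ∧
    (∀ b b' : Fin 2, (Pic * H0' * Pic).mulVec (enc b b') = 0) := by
  refine ⟨enc_mem_C2, fun b b' => ?_⟩
  rw [← mulVec_mulVec, Pic_mulVec_of_mem (enc_mem_C2 b b'), ← mulVec_mulVec, enc_eq_sum_ket,
    H0'_mulVec_sum_ket (sum_encCoeff b) (sum_encCoeff b'), mulVec_zero]

end
end
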